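/- arXiv:2206.07126 — 3 statements merged into one kernel-verified Lean document; each statement's English description precedes it below -/
import Mathlib

section
/- In the per-step LAZOb setup, let A^s = A ∩ (−A) be the largest symmetric subset of A, and define the bias term b(u) = (d/(2δ))·(f_t(x_t + δu) − 2f_{t−1}(w_{t−1}) + f_t(x_t − δu))·u·1_{A∖A^s}(u). Then E_u[g(u)] = ∇f_{δ,t}(x_t) + E_u[b(u)], where f_{δ,t} is the smoothed version of f_t. -/
open MeasureTheory Pointwise

/-- The uniform probability measure on the closed unit ball of `ℝ^d`. -/
noncomputable def ballUniform (d : ℕ) : Measure (EuclideanSpace ℝ (Fin d)) :=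
  (volume (Metric.closedBall (0 : EuclideanSpace ℝ (Fin d)) 1))⁻¹ •
    volume.restrict (Metric.closedBall (0 : EuclideanSpace ℝ (Fin d)) 1)

/-- The uniform (rotation-invariant) probability measure on the unit sphere of `ℝ^d`,
realized as the pushforward of the uniform measure on the unit ball under the radial
projection `v ↦ v / ‖v‖`. -/
noncomputable def sphereUniform (d : ℕ) : Measure (EuclideanSpace ℝ (Fin d)) :=
  Measure.map (fun v => ‖v‖⁻¹ • v) (ballUniform d)

/-- The smoothed version `f_δ(x) = E_{v ~ uniform ball} [f (x + δ v)]`. -/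
noncomputable def smoothed (d : ℕ) (f : EuclideanSpace ℝ (Fin d) → ℝ) (δ : ℝ)
    (x : EuclideanSpace ℝ (Fin d)) : ℝ :=
  ∫ v, f (x + δ • v) ∂(ballUniform d)

/-- The asymmetric part `A ∖ A^s` of a set, where `A^s = A ∩ (−A)` is the largest
symmetric subset of `A`. -/
def asymPart {d : ℕ} (A : Set (EuclideanSpace ℝ (Fin d))) : Set (EuclideanSpace ℝ (Fin d)) :=
  A \ (A ∩ -A)

section RadialIntegration

open Filter Topology Metric
open scoped RealInnerProductSpace NNReal

section Normed

variable {E : Type*} [NormedAddCommGroup E]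

/-- A radial cutoff which is constant on `ball 0 s`, vanishes outside of `ball 0 1`, and is affine in
the norm in between. -/
noncomputable def radialCutoff (s : ℝ) (v : E) : ℝ := max 0 (min (1 - s) (1 - ‖v‖))

lemma radialCutoff_lipschitzWith (s : ℝ) : LipschitzWith 1 (radialCutoff (E := E) s) := by
  have h : LipschitzWith 1 (fun v : E => 1 - ‖v‖) := by
    simpa using (LipschitzWith.const (1 : ℝ)).sub (lipschitzWith_one_norm (E := E))
  exact (h.const_min (1 - s)).const_max 0

lemma radialCutoff_nonneg (s : ℝ) (v : E) : 0 ≤ radialCutoff s v := le_max_left _ _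

lemma radialCutoff_le {s : ℝ} (hs : s < 1) (v : E) : radialCutoff s v ≤ 1 - s :=
  max_le (by linarith) (min_le_left _ _)

lemma radialCutoff_of_norm_le {s : ℝ} (hs : s < 1) {v : E} (hv : ‖v‖ ≤ s) :
    radialCutoff s v = 1 - s := by
  rw [radialCutoff, min_eq_left (by linarith), max_eq_right (by linarith)]

lemma radialCutoff_of_le_norm {s : ℝ} {v : E} (h1 : s ≤ ‖v‖) (h2 : ‖v‖ ≤ 1) :
    radialCutoff s v = 1 - ‖v‖ := by
  rw [radialCutoff, min_eq_right (by linarith), max_eq_right (by linarith)]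

lemma radialCutoff_of_one_le {s : ℝ} {v : E} (hv : 1 ≤ ‖v‖) :
    radialCutoff s v = 0 := by
  rw [radialCutoff, max_eq_left ((min_le_right _ _).trans (by linarith))]

lemma radialCutoff_hasCompactSupport [NormedSpace ℝ E] [FiniteDimensional ℝ E] (s : ℝ) :
    HasCompactSupport (radialCutoff (E := E) s) := by
  have := FiniteDimensional.proper_real E
  refine HasCompactSupport.intro (isCompact_closedBall (0 : E) 1) fun v hv => ?_
  rw [mem_closedBall_zero_iff, not_le] at hv
  exact radialCutoff_of_one_le hv.le

variable [NormedSpace ℝ E]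

lemma normalize_smul_of_pos {s : ℝ} (hs : 0 < s) (v : E) : ‖s • v‖⁻¹ • s • v = ‖v‖⁻¹ • v := by
  rw [norm_smul, Real.norm_of_nonneg hs.le, smul_smul, mul_inv, mul_assoc, mul_comm, mul_assoc,
    mul_inv_cancel₀ hs.ne', mul_one]

lemma norm_normalize_le_one (v : E) : ‖‖v‖⁻¹ • v‖ ≤ 1 := by
  rw [norm_smul, norm_inv, norm_norm]
  exact inv_mul_le_one

lemma norm_sub_normalize {v : E} (hv : v ≠ 0) : ‖v - ‖v‖⁻¹ • v‖ = |‖v‖ - 1| := by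
  have hn : ‖v‖ ≠ 0 := by simpa using hv
  have : v - ‖v‖⁻¹ • v = ((‖v‖ - 1) * ‖v‖⁻¹) • v := by
    rw [sub_mul, mul_inv_cancel₀ hn, one_mul, sub_smul, one_smul]
  rw [this, norm_smul, norm_mul, norm_inv, norm_norm, mul_assoc, inv_mul_cancel₀ hn, mul_one,
    Real.norm_eq_abs]

end Normed

variable {E : Type*} [NormedAddCommGroup E] [InnerProductSpace ℝ E]

lemma hasLineDerivAt_norm {v : E} (hv : v ≠ 0) (w : E) :
    HasLineDerivAt ℝ (fun x : E => ‖x‖) ⟪‖v‖⁻¹ • v, w⟫ v w := by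
  have h := ((hasStrictFDerivAt_norm_sq v).hasFDerivAt.sqrt (by simpa using hv)).hasLineDerivAt w
  have hn : ‖v‖ ≠ 0 := by simpa using hv
  have e : (fun x : E => √(‖x‖ ^ 2)) = fun x => ‖x‖ := by
    funext x; exact Real.sqrt_sq (norm_nonneg x)
  rw [e] at h
  convert h using 1
  simp [Real.sqrt_sq, inner_smul_left]
  ring

lemma abs_inner_normalize_le (v w : E) : |⟪‖v‖⁻¹ • v, w⟫| ≤ ‖w‖ := by
  refine (abs_real_inner_le_norm _ _).trans (mul_le_of_le_one_left (norm_nonneg _) ?_)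
  rw [norm_smul, norm_inv, norm_norm]
  exact inv_mul_le_one

lemma lineDeriv_radialCutoff {s : ℝ} (hs0 : 0 < s) (hs : s < 1) {v : E} (h1 : ‖v‖ ≠ 1)
    (h2 : ‖v‖ ≠ s) (w : E) :
    lineDeriv ℝ (radialCutoff s) v (-w) =
      (ball (0 : E) 1 \ ball 0 s).indicator (fun v => ⟪‖v‖⁻¹ • v, w⟫) v := by
  have hc : Continuous (fun x : E => ‖x‖) := continuous_norm
  rcases lt_or_gt_of_ne h2 with h | h
  · have : radialCutoff s =ᶠ[𝓝 v] fun _ => 1 - s := by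
      filter_upwards [hc.continuousAt.eventually_lt continuousAt_const h] with x hx
      exact radialCutoff_of_norm_le hs hx.le
    rw [this.lineDeriv_eq, (hasFDerivAt_const _ v).hasLineDerivAt (-w) |>.lineDeriv, zero_apply, Set.indicator_of_notMem (by simp [h])]
  rcases lt_or_gt_of_ne h1 with h' | h'
  · have : radialCutoff s =ᶠ[𝓝 v] fun x => 1 - ‖x‖ := by
      filter_upwards [hc.continuousAt.eventually_lt continuousAt_const h',
        continuousAt_const.eventually_lt hc.continuousAt h] with x hx hx'
      exact radialCutoff_of_le_norm hx'.le hx.le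
    have hv : v ≠ 0 := by rintro rfl; simp at h; linarith
    rw [this.lineDeriv_eq, Set.indicator_of_mem (by simp [h.le, h'])]
    have := HasDerivAt.const_sub (1 : ℝ) (hasLineDerivAt_norm hv (-w))
    have h3 : HasLineDerivAt ℝ (fun x : E => 1 - ‖x‖) (-⟪‖v‖⁻¹ • v, -w⟫) v (-w) := this
    rw [h3.lineDeriv, inner_neg_right, neg_neg]
  · have : radialCutoff s =ᶠ[𝓝 v] fun _ => 0 := by
      filter_upwards [continuousAt_const.eventually_lt hc.continuousAt h'] with x hx
      exact radialCutoff_of_one_le hx.le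
    rw [this.lineDeriv_eq, (hasFDerivAt_const _ v).hasLineDerivAt (-w) |>.lineDeriv, zero_apply, Set.indicator_of_notMem (by simp [h'.le])]

variable [FiniteDimensional ℝ E] [MeasurableSpace E] [BorelSpace E]
  (μ : Measure E) [μ.IsAddHaarMeasure]

lemma setIntegral_shell_of_homogeneous {K : E → ℝ} (hK : IntegrableOn K (ball 0 1) μ)
    (hom : ∀ s : ℝ, 0 < s → ∀ v, K (s • v) = K v) {s : ℝ} (hs0 : 0 < s) (hs : s < 1) :
    ∫ v in ball 0 1 \ ball 0 s, K v ∂μ =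
      (1 - s ^ Module.finrank ℝ E) * ∫ v in ball 0 1, K v ∂μ := by
  rw [setIntegral_sdiff measurableSet_ball hK (ball_subset_ball hs.le)]
  have h := Measure.setIntegral_comp_smul_of_pos μ K (ball 0 1) hs0
  simp_rw [hom s hs0] at h
  rw [smul_unitBall_of_pos hs0, smul_eq_mul] at h
  have hp : s ^ Module.finrank ℝ E ≠ 0 := by positivity
  rw [h]
  field_simp

lemma tendsto_one_sub_pow_div (n : ℕ) :
    Tendsto (fun s : ℝ => (1 - s)⁻¹ * (1 - s ^ n)) (𝓝[<] 1) (𝓝 n) := by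
  have h := (hasDerivAt_iff_tendsto_slope.1 (hasDerivAt_pow n (1 : ℝ))).mono_left
    (nhdsWithin_mono 1 (fun x (hx : x < 1) => hx.ne) : 𝓝[<] (1 : ℝ) ≤ _)
  simp only [one_pow, mul_one] at h
  refine h.congr fun s => ?_
  rw [slope_def_field, one_pow, div_eq_inv_mul, ← neg_sub 1 s, ← neg_sub 1 (s ^ n), inv_neg,
    neg_mul_neg]

lemma measurable_normalize : Measurable fun v : E => ‖v‖⁻¹ • v :=
  measurable_norm.inv.smul measurable_id

/-- The divergence theorem on the unit ball for Lipschitz functions, with the surface integral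
expressed through the radial projection of the ball. -/
theorem LipschitzWith.setIntegral_ball_lineDeriv {F : E → ℝ} {C : ℝ≥0} (hF : LipschitzWith C F)
    (w : E) :
    ∫ v in ball 0 1, lineDeriv ℝ F v w ∂μ =
      Module.finrank ℝ E * ∫ v in ball 0 1, F (‖v‖⁻¹ • v) * ⟪‖v‖⁻¹ • v, w⟫ ∂μ := by
  set K : E → ℝ := fun v => F (‖v‖⁻¹ • v) * ⟪‖v‖⁻¹ • v, w⟫ with hKdef
  set n := Module.finrank ℝ E
  have hev : ∀ᶠ s : ℝ in 𝓝[<] 1, 0 < s ∧ s < 1 := by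
    filter_upwards [Ioo_mem_nhdsLT (zero_lt_one (α := ℝ))] with s hs using hs
  have hfin : μ (ball (0 : E) 1) ≠ ⊤ := measure_ball_lt_top.ne
  have hFm := hF.continuous.measurable
  have hNm : Measurable fun v : E => ⟪‖v‖⁻¹ • v, w⟫ := measurable_normalize.inner_const
  have hKint : IntegrableOn K (ball 0 1) μ := by
    obtain ⟨M, hM⟩ := (isCompact_closedBall (0 : E) 1).exists_bound_of_continuousOn
      hF.continuous.continuousOn
    refine Measure.integrableOn_of_bounded (M := M * ‖w‖) hfin
      ((hFm.comp measurable_normalize).mul hNm).aestronglyMeasurable (.of_forall fun v => ?_)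
    rw [hKdef, norm_mul]
    have h1 := hM (‖v‖⁻¹ • v) (by simpa using norm_normalize_le_one v)
    exact mul_le_mul h1 (abs_inner_normalize_le v w) (norm_nonneg _)
      ((norm_nonneg _).trans h1)
  have hKhom : ∀ s : ℝ, 0 < s → ∀ v, K (s • v) = K v := fun s hs v => by
    simp only [hKdef, normalize_smul_of_pos hs]
  have hlhs : Tendsto (fun s : ℝ => (1 - s)⁻¹ * ∫ v, lineDeriv ℝ F v w * radialCutoff s v ∂μ)
      (𝓝[<] 1) (𝓝 (∫ v in ball 0 1, lineDeriv ℝ F v w ∂μ)) := by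
    simp_rw [← integral_const_mul]
    rw [← integral_indicator measurableSet_ball]
    refine tendsto_integral_filter_of_dominated_convergence
      ((ball (0 : E) 1).indicator fun _ => C * ‖w‖) (.of_forall fun s => ?_) ?_ ?_ ?_
    · exact (((measurable_lineDeriv hF.continuous).mul
        (radialCutoff_lipschitzWith s).continuous.measurable).const_mul _).aestronglyMeasurable
    · filter_upwards [hev] with s ⟨hs0, hs⟩
      refine .of_forall fun v => ?_
      by_cases hv : v ∈ ball (0 : E) 1
      · rw [Set.indicator_of_mem hv, norm_mul, norm_mul, norm_inv,
          Real.norm_of_nonneg (radialCutoff_nonneg s v), Real.norm_of_nonneg (by linarith)]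
        have h1 := radialCutoff_le hs v
        have h2 := norm_lineDeriv_le_of_lipschitz ℝ hF (x₀ := v) (v := w)
        have h3 : 0 < 1 - s := by linarith
        calc (1 - s)⁻¹ * (‖lineDeriv ℝ F v w‖ * radialCutoff s v)
            ≤ (1 - s)⁻¹ * ((C * ‖w‖) * (1 - s)) := by
              gcongr
              exact radialCutoff_nonneg s v
          _ = C * ‖w‖ := by field_simp
      · rw [Set.indicator_of_notMem hv, radialCutoff_of_one_le (by simpa using hv)]
        simp
    · exact (integrable_indicator_iff measurableSet_ball).2 (integrableOn_const hfin)
    · refine .of_forall fun v => ?_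
      by_cases hv : v ∈ ball (0 : E) 1
      · rw [Set.indicator_of_mem hv]
        refine tendsto_const_nhds.congr' ?_
        filter_upwards [hev, Ioo_mem_nhdsLT (by simpa using hv : ‖v‖ < 1)] with s hs hvs
        have h3 : 1 - s ≠ 0 := by linarith [hs.2]
        rw [radialCutoff_of_norm_le hs.2 hvs.1.le]
        field_simp
      · rw [Set.indicator_of_notMem hv]
        refine tendsto_const_nhds.congr fun s => ?_
        rw [radialCutoff_of_one_le (by simpa using hv)]
        simp
  have hparts : ∀ s : ℝ, 0 < s → s < 1 → ∫ v, lineDeriv ℝ F v w * radialCutoff s v ∂μ =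
      ∫ v in ball 0 1 \ ball 0 s, F v * ⟪‖v‖⁻¹ • v, w⟫ ∂μ := by
    intro s hs0 hs
    rw [hF.integral_lineDeriv_mul_eq (radialCutoff_lipschitzWith s)
      (radialCutoff_hasCompactSupport s), ← integral_indicator
      (measurableSet_ball.diff measurableSet_ball)]
    refine integral_congr_ae ?_
    have hn1 : ∀ᵐ v ∂μ, v ∉ sphere (0 : E) 1 :=
      measure_eq_zero_iff_ae_notMem.1 (Measure.addHaar_sphere_of_ne_zero μ 0 one_ne_zero)
    have hn2 : ∀ᵐ v ∂μ, v ∉ sphere (0 : E) s :=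
      measure_eq_zero_iff_ae_notMem.1 (Measure.addHaar_sphere_of_ne_zero μ 0 hs0.ne')
    filter_upwards [hn1, hn2] with v h1 h2
    rw [lineDeriv_radialCutoff hs0 hs (by simpa using h1) (by simpa using h2), mul_comm,
      Set.indicator_mul_right]
  have hshell : ∀ s : ℝ, 0 < s → s < 1 →
      |(∫ v in ball 0 1 \ ball 0 s, F v * ⟪‖v‖⁻¹ • v, w⟫ ∂μ) -
        (1 - s ^ n) * ∫ v in ball 0 1, K v ∂μ| ≤
      C * (1 - s) * ‖w‖ * ((1 - s ^ n) * μ.real (ball 0 1)) := by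
    intro s hs0 hs
    have hlt : μ (ball (0 : E) 1 \ ball 0 s) < ⊤ :=
      (measure_mono Set.sdiff_subset).trans_lt measure_ball_lt_top
    have hvol := setIntegral_shell_of_homogeneous μ (K := fun _ => 1)
      (integrableOn_const hfin) (fun _ _ _ => rfl) hs0 hs
    simp only [setIntegral_const, smul_eq_mul, mul_one] at hvol
    rw [← setIntegral_shell_of_homogeneous μ hKint hKhom hs0 hs, ← hvol, ← integral_sub]
    · rw [← Real.norm_eq_abs]
      refine norm_setIntegral_le_of_norm_le_const hlt fun v hv => ?_
      have hv1 : ‖v‖ < 1 := by simpa using hv.1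
      have hv2 : s ≤ ‖v‖ := by simpa using hv.2
      have hv0 : v ≠ 0 := by rintro rfl; simp at hv2; linarith
      rw [hKdef, ← sub_mul, norm_mul]
      refine mul_le_mul ((hF.norm_sub_le _ _).trans ?_) (abs_inner_normalize_le v w)
        (norm_nonneg _) (mul_nonneg C.coe_nonneg (by linarith))
      rw [norm_sub_normalize hv0, abs_of_nonpos (by linarith)]
      gcongr
      linarith
    · obtain ⟨M, hM⟩ := (isCompact_closedBall (0 : E) 1).exists_bound_of_continuousOn
        hF.continuous.continuousOn
      refine Measure.integrableOn_of_bounded (M := M * ‖w‖) hlt.ne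
        (hFm.mul hNm).aestronglyMeasurable ?_
      refine (ae_restrict_mem (measurableSet_ball.diff measurableSet_ball)).mono fun v hv => ?_
      rw [norm_mul]
      have h1 := hM v (ball_subset_closedBall hv.1)
      exact mul_le_mul h1 (abs_inner_normalize_le v w) (norm_nonneg _)
        ((norm_nonneg _).trans h1)
    · exact hKint.mono_set Set.sdiff_subset
  have hrhs : Tendsto (fun s : ℝ => (1 - s)⁻¹ * ∫ v, lineDeriv ℝ F v w * radialCutoff s v ∂μ)
      (𝓝[<] 1) (𝓝 (n * ∫ v in ball 0 1, K v ∂μ)) := by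
    have h1 := (tendsto_one_sub_pow_div n).mul_const (∫ v in ball 0 1, K v ∂μ)
    have h2 : Tendsto (fun s : ℝ => C * ‖w‖ * ((1 - s ^ n) * μ.real (ball (0 : E) 1)))
        (𝓝[<] 1) (𝓝 0) := by
      have : Continuous fun s : ℝ => C * ‖w‖ * ((1 - s ^ n) * μ.real (ball (0 : E) 1)) := by
        fun_prop
      simpa using (this.tendsto 1).mono_left nhdsWithin_le_nhds
    have h3 := squeeze_zero_norm' (f := fun s : ℝ =>
      (1 - s)⁻¹ * (∫ v, lineDeriv ℝ F v w * radialCutoff s v ∂μ) -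
        (1 - s)⁻¹ * (1 - s ^ n) * ∫ v in ball 0 1, K v ∂μ) ?_ h2
    · simpa using h3.add h1
    · filter_upwards [hev] with s ⟨hs0, hs⟩
      have h4 : 0 < 1 - s := by linarith
      rw [hparts s hs0 hs, mul_assoc, ← mul_sub, norm_mul, norm_inv, Real.norm_of_nonneg h4.le,
        inv_mul_le_iff₀ h4]
      exact (hshell s hs0 hs).trans_eq (by ring)
  exact tendsto_nhds_unique hlhs hrhs

end RadialIntegration

section Uniform

open Metric
open scoped RealInnerProductSpace NNReal

variable {d : ℕ}

local notation "𝔼" => EuclideanSpace ℝ (Fin d)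

instance : IsProbabilityMeasure (ballUniform d) := by
  refine ⟨?_⟩
  rw [ballUniform, Measure.smul_apply, Measure.restrict_apply_univ, smul_eq_mul]
  exact ENNReal.inv_mul_cancel (measure_closedBall_pos _ _ one_pos).ne' measure_closedBall_lt_top.ne

instance : IsProbabilityMeasure (sphereUniform d) :=
  Measure.isProbabilityMeasure_map measurable_normalize.aemeasurable

lemma ae_ballUniform_of_ae {p : 𝔼 → Prop} (h : ∀ᵐ v, p v) : ∀ᵐ v ∂(ballUniform d), p v :=
  Measure.ae_smul_measure (ae_restrict_of_ae h) _

lemma ae_norm_le_one_ballUniform : ∀ᵐ v ∂(ballUniform d), ‖v‖ ≤ 1 :=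
  Measure.ae_smul_measure ((ae_restrict_mem measurableSet_closedBall).mono fun v hv => by
    simpa using hv) _

lemma ae_norm_le_one_sphereUniform : ∀ᵐ u ∂(sphereUniform d), ‖u‖ ≤ 1 :=
  (ae_map_iff measurable_normalize.aemeasurable (measurableSet_le measurable_norm
    measurable_const)).2 (.of_forall norm_normalize_le_one)

lemma integrable_of_ae_norm_le_one {G : Type*} [NormedAddCommGroup G]
    {ν : Measure 𝔼} [IsFiniteMeasure ν] (hν : ∀ᵐ v ∂ν, ‖v‖ ≤ 1) {h : 𝔼 → G} (hh : Continuous h) :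
    Integrable h ν := by
  obtain ⟨M, hM⟩ := (isCompact_closedBall (0 : 𝔼) 1).exists_bound_of_continuousOn hh.continuousOn
  refine Integrable.of_bound hh.aestronglyMeasurable M ?_
  filter_upwards [hν] with v hv using hM v (by simpa using hv)

lemma closedBall_ae_eq_ball :
    (closedBall (0 : 𝔼) 1 : Set 𝔼) =ᵐ[volume] ball 0 1 := by
  rw [← ball_union_sphere]
  exact union_ae_eq_left_of_ae_eq_empty
    (ae_eq_empty.2 (Measure.addHaar_sphere_of_ne_zero volume 0 one_ne_zero))

lemma integral_ballUniform (h : 𝔼 → ℝ) :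
    ∫ v, h v ∂(ballUniform d) =
      (volume (closedBall (0 : 𝔼) 1))⁻¹.toReal * ∫ v in ball 0 1, h v := by
  rw [ballUniform, integral_smul_measure, smul_eq_mul,
    setIntegral_congr_set closedBall_ae_eq_ball]

instance : (ballUniform d).IsNegInvariant := by
  refine ⟨?_⟩
  rw [ballUniform, Measure.neg, Measure.map_smul]
  congr 1
  have h := Measure.restrict_map (μ := (volume : Measure 𝔼)) measurable_neg
    (measurableSet_closedBall (x := (0 : 𝔼)) (ε := 1))
  have h2 : Neg.neg ⁻¹' closedBall (0 : 𝔼) 1 = closedBall 0 1 := by ext; simp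
  rw [h2, Measure.map_neg_eq_self] at h
  exact h.symm

instance : (sphereUniform d).IsNegInvariant := by
  refine ⟨?_⟩
  rw [sphereUniform, Measure.neg, Measure.map_map measurable_neg measurable_normalize]
  conv_rhs => rw [← Measure.map_neg_eq_self (ballUniform d),
    Measure.map_map measurable_normalize measurable_neg]
  congr 1
  funext v
  simp

lemma integral_sphereUniform_eq_zero_of_odd {h : 𝔼 → 𝔼} (hh : ∀ u, h (-u) = -h u) :
    ∫ u, h u ∂(sphereUniform d) = 0 := by
  have := integral_neg_eq_self h (sphereUniform d)
  simp_rw [hh, integral_neg] at this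
  have h2 : (2 : ℝ) • ∫ u, h u ∂(sphereUniform d) = 0 := by
    rw [two_smul]
    nth_rewrite 1 [← this]
    exact neg_add_cancel _
  simpa using h2

/-- The gradient of the smoothed version of a Lipschitz function, as an average over the sphere. -/
theorem hasGradientAt_smoothed {f : 𝔼 → ℝ} {C : ℝ≥0} (hf : LipschitzWith C f) {δ : ℝ} (hδ : 0 < δ)
    (x : 𝔼) :
    HasGradientAt (smoothed d f δ)
      (((d : ℝ) / δ) • ∫ u, f (x + δ • u) • u ∂(sphereUniform d)) x := by
  set F : 𝔼 → ℝ := fun v => f (x + δ • v) with hFdef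
  have hF : LipschitzWith (C * δ.toNNReal) F := by
    refine hf.comp (LipschitzWith.of_dist_le_mul fun v w => ?_)
    rw [dist_add_left, dist_smul₀, Real.norm_of_nonneg hδ.le, Real.coe_toNNReal _ hδ.le]
  have hdiff : ∀ᵐ v ∂(ballUniform d),
      HasFDerivAt (fun y => f (y + δ • v)) (δ⁻¹ • fderiv ℝ F v) x := by
    refine ae_ballUniform_of_ae (hF.ae_differentiableAt.mono fun v hv => ?_)
    have h1 : HasFDerivAt (fun y : 𝔼 => δ⁻¹ • (y - x) + v)
        (δ⁻¹ • ContinuousLinearMap.id ℝ 𝔼) x :=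
      (((hasFDerivAt_id x).sub_const x).const_smul δ⁻¹).add_const v
    have h2 : HasFDerivAt F (fderiv ℝ F v) (δ⁻¹ • (x - x) + v) := by
      simpa using hv.hasFDerivAt
    have h3 := h2.comp x h1
    have h4 : (F ∘ fun y : 𝔼 => δ⁻¹ • (y - x) + v) = fun y => f (y + δ • v) := by
      funext y
      simp only [hFdef, Function.comp, smul_add, smul_smul, mul_inv_cancel₀ hδ.ne', one_smul]
      congr 1
      abel
    rw [h4, ContinuousLinearMap.comp_smul, ContinuousLinearMap.comp_id] at h3
    exact h3
  have hfc := hf.continuous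
  have hmeas : ∀ y ∈ (Set.univ : Set 𝔼),
      AEStronglyMeasurable (fun v => f (y + δ • v)) (ballUniform d) := fun y _ =>
    Continuous.aestronglyMeasurable (by fun_prop)
  have hlip : ∀ᵐ v ∂(ballUniform d), ∀ y ∈ (Set.univ : Set 𝔼),
      ‖f (y + δ • v) - f (x + δ • v)‖ ≤ C * ‖y - x‖ :=
    .of_forall fun v y _ => by simpa using hf.norm_sub_le (y + δ • v) (x + δ • v)
  have hmeas' : AEStronglyMeasurable (fun v => δ⁻¹ • fderiv ℝ F v) (ballUniform d) :=
    ((measurable_fderiv ℝ F).const_smul δ⁻¹).aestronglyMeasurable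
  have key := hasFDerivAt_integral_of_dominated_loc_of_lip' Filter.univ_mem hmeas
    (integrable_of_ae_norm_le_one ae_norm_le_one_ballUniform hF.continuous) hmeas' hlip
    (integrable_const _) hdiff
  rw [hasGradientAt_iff_hasFDerivAt]
  suffices heq : InnerProductSpace.toDual ℝ 𝔼
      (((d : ℝ) / δ) • ∫ u, f (x + δ • u) • u ∂(sphereUniform d)) =
      ∫ v, δ⁻¹ • fderiv ℝ F v ∂(ballUniform d) by
    rw [heq]
    exact key.2
  refine ContinuousLinearMap.ext fun w => ?_
  rw [InnerProductSpace.toDual_apply_apply, ContinuousLinearMap.integral_apply key.1]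
  have hG : Continuous fun u : 𝔼 => F u • u := hF.continuous.smul continuous_id
  have hline : ∀ᵐ v ∂(ballUniform d), (δ⁻¹ • fderiv ℝ F v) w = δ⁻¹ * lineDeriv ℝ F v w :=
    ae_ballUniform_of_ae (hF.ae_differentiableAt.mono fun v hv => by
      rw [hv.lineDeriv_eq_fderiv, smul_apply, smul_eq_mul])
  rw [integral_congr_ae hline, integral_const_mul, integral_ballUniform,
    hF.setIntegral_ball_lineDeriv volume, finrank_euclideanSpace_fin, real_inner_smul_left,
    real_inner_comm, ← integral_inner (integrable_of_ae_norm_le_one ae_norm_le_one_sphereUniform hG),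
    sphereUniform, integral_map measurable_normalize.aemeasurable
      (continuous_const.inner hG).aestronglyMeasurable, integral_ballUniform]
  simp only [real_inner_smul_right, real_inner_comm]
  ring

end Uniform

/-- Bias identity for the (per-step) LAZOb gradient estimator (Lemma 3, part (b)):
`E_u[g(u)] = ∇f_{δ,t}(x_t) + E_u[b(u)]`. -/
theorem stmt9 (d : ℕ) (hd : 1 ≤ d) (δ η D L : ℝ) (hδ : 0 < δ) (hη : 0 < η) (hD : 0 < D)
    (hL : 0 ≤ L)
    (ft ftm : EuclideanSpace ℝ (Fin d) → ℝ)
    (hft : ∀ x y, |ft x - ft y| ≤ L * ‖x - y‖)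
    (hftm : ∀ x y, |ftm x - ftm y| ≤ L * ‖x - y‖)
    (xt xtm utm : EuclideanSpace ℝ (Fin d)) (hutm : ‖utm‖ = 1) :
    (∫ u, (if |ft (xt + δ • u) - ftm (xtm + δ • utm)| ≤ D * η * L then
            ((d : ℝ) / δ * (ft (xt + δ • u) - ftm (xtm + δ • utm))) • u
          else
            ((d : ℝ) / (2 * δ) * (ft (xt + δ • u) - ft (xt - δ • u))) • u)
        ∂(sphereUniform d)) =
      gradient (smoothed d ft δ) xt +
        ∫ u, (asymPart
            {w : EuclideanSpace ℝ (Fin d) |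
              |ft (xt + δ • w) - ftm (xtm + δ • utm)| ≤ D * η * L}).indicator
          (fun u => ((d : ℝ) / (2 * δ) *
            (ft (xt + δ • u) - 2 * ftm (xtm + δ • utm) + ft (xt - δ • u))) • u) u
          ∂(sphereUniform d) := by
  set c := ftm (xtm + δ • utm)
  set A : Set (EuclideanSpace ℝ (Fin d)) := {w | |ft (xt + δ • w) - c| ≤ D * η * L}
  have hLip : LipschitzWith L.toNNReal ft := LipschitzWith.of_dist_le_mul fun x y => by
    rw [Real.dist_eq, dist_eq_norm, Real.coe_toNNReal _ hL]
    exact hft x y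
  have hc := hLip.continuous
  have hAm : MeasurableSet A := measurableSet_le
    (by have : Continuous fun w => |ft (xt + δ • w) - c| := by fun_prop
        exact this.measurable) measurable_const
  have hSm : MeasurableSet (A ∩ -A) := hAm.inter hAm.neg
  have hint : ∀ {h : EuclideanSpace ℝ (Fin d) → EuclideanSpace ℝ (Fin d)}, Continuous h →
      Integrable h (sphereUniform d) := fun hh =>
    integrable_of_ae_norm_le_one ae_norm_le_one_sphereUniform hh
  set h : EuclideanSpace ℝ (Fin d) → EuclideanSpace ℝ (Fin d) := fun u =>
    ((d : ℝ) / (2 * δ) * (ft (xt + δ • u) - 2 * c + ft (xt - δ • u))) • u with hh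
  have hhc : Continuous h := by fun_prop
  have hasym : Integrable ((asymPart A).indicator h) (sphereUniform d) :=
    (hint hhc).indicator (hAm.diff hSm)
  have hhodd : ∀ u, h (-u) = -h u := fun u => by
    simp only [hh, smul_neg, sub_neg_eq_add, ← sub_eq_add_neg]
    congr 3
    ring
  have hsym : ∫ u, (A ∩ -A).indicator h u ∂(sphereUniform d) = 0 := by
    refine integral_sphereUniform_eq_zero_of_odd fun u => ?_
    have hmem : -u ∈ A ∩ -A ↔ u ∈ A ∩ -A := by simp [and_comm]
    by_cases hu : u ∈ A ∩ -A
    · rw [Set.indicator_of_mem hu, Set.indicator_of_mem (hmem.2 hu), hhodd]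
    · rw [Set.indicator_of_notMem hu, Set.indicator_of_notMem (mt hmem.1 hu), neg_zero]
  set T : EuclideanSpace ℝ (Fin d) → EuclideanSpace ℝ (Fin d) := fun u =>
    ((d : ℝ) / (2 * δ) * (ft (xt + δ • u) - ft (xt - δ • u))) • u with hT
  have hTc : Continuous T := by fun_prop
  have hTint : ∫ u, T u ∂(sphereUniform d) = gradient (smoothed d ft δ) xt := by
    rw [(hasGradientAt_smoothed hLip hδ xt).gradient, ← integral_smul, ← sub_eq_zero,
      ← integral_sub (hint hTc) (hint (by fun_prop))]
    refine integral_sphereUniform_eq_zero_of_odd fun u => ?_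
    simp only [hT, smul_neg, sub_neg_eq_add, ← sub_eq_add_neg]
    module
  rw [← hTint, ← add_zero (∫ u, T u ∂(sphereUniform d)), ← hsym,
    ← integral_add (hint hTc) ((hint hhc).indicator hSm), ← integral_add (f := fun u => T u + (A ∩ -A).indicator h u)
      ((hint hTc).add ((hint hhc).indicator hSm)) hasym]
  refine integral_congr_ae (.of_forall fun u => ?_)
  have hsplit : (A ∩ -A).indicator h u + (asymPart A).indicator h u = A.indicator h u := by
    by_cases h1 : u ∈ A <;> by_cases h2 : -u ∈ A <;> simp [asymPart, h1, h2]
  simp only [add_assoc, hsplit]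
  by_cases hu : u ∈ A
  · rw [Set.indicator_of_mem hu, if_pos (by exact hu), hT, hh, ← add_smul]
    congr 1
    field_simp
    ring
  · rw [Set.indicator_of_notMem hu, if_neg (by exact hu), add_zero]
end

section
/- In the per-step LAZOa setup, let Ã^s = Ã ∩ (−Ã) be the largest symmetric subset of Ã, and define the bias term b̃(u) = (d/(2δ))·(f_t(x_t + δu) − 2f_{t−1}(w_{t−1}) + f_t(x_t − δu))·u·1_{Ã∖Ã^s}(u). If v ∈ ℝ^d satisfies ‖x_t − x_{t−1}‖ ≤ η‖v‖, then E_u[‖b̃(u)‖] ≤ (dL + 2dD + (dDη/δ)‖v‖)·σ(Ã∖Ã^s). -/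
open MeasureTheory Pointwise

instance isFiniteMeasure_ballUniform (d : ℕ) : IsFiniteMeasure (ballUniform d) := by
  refine ⟨?_⟩
  rw [ballUniform, Measure.smul_apply, smul_eq_mul]
  refine ENNReal.mul_lt_top ?_ ?_
  · exact ENNReal.inv_lt_top.2 (Metric.measure_closedBall_pos volume _ one_pos)
  · rw [Measure.restrict_apply_univ]
    exact measure_closedBall_lt_top

instance isFiniteMeasure_sphereUniform (d : ℕ) : IsFiniteMeasure (sphereUniform d) := by
  unfold sphereUniform
  infer_instance

theorem ae_sphereUniform_norm_le_one (d : ℕ) : ∀ᵐ u ∂(sphereUniform d), ‖u‖ ≤ 1 := by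
  have hm : Measurable fun v : EuclideanSpace ℝ (Fin d) => ‖v‖⁻¹ • v :=
    measurable_norm.inv.smul measurable_id
  rw [sphereUniform,
    ae_map_iff hm.aemeasurable (isClosed_le continuous_norm continuous_const).measurableSet]
  refine Filter.Eventually.of_forall fun v => ?_
  rw [norm_smul, norm_inv, norm_norm]
  exact inv_mul_le_one

theorem measurableSet_asymPart {d : ℕ} {A : Set (EuclideanSpace ℝ (Fin d))}
    (hA : MeasurableSet A) : MeasurableSet (asymPart A) :=
  hA.diff (hA.inter hA.neg)

/-- If `‖g‖ ≤ C` almost everywhere on `S`, then the integral of `‖g‖` over `S` is at most `C μ(S)`. -/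
theorem integral_norm_indicator_le {α E : Type*} [MeasurableSpace α] [NormedAddCommGroup E]
    {μ : Measure α} [IsFiniteMeasure μ] {S : Set α} (hS : MeasurableSet S) {g : α → E} {C : ℝ}
    (hg : ∀ᵐ u ∂μ, u ∈ S → ‖g u‖ ≤ C) :
    ∫ u, ‖S.indicator g u‖ ∂μ ≤ C * (μ S).toReal := by
  have hC : ∫ u, S.indicator (fun _ => C) u ∂μ = C * (μ S).toReal := by
    rw [integral_indicator_const C hS, smul_eq_mul, mul_comm, Measure.real]
  rw [← hC]
  refine integral_mono_of_nonneg (Filter.Eventually.of_forall fun u => norm_nonneg _)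
    ((integrable_const C).indicator hS) ?_
  filter_upwards [hg] with u hu
  by_cases h : u ∈ S
  · simpa [h] using hu h
  · simp [h]

/-- Pointwise bound on the symmetrized two-point estimator at a direction `u` where `f` satisfies
the acceptance test `|f (x + δ u) - c| ≤ D ‖x - y + δ (u - e)‖`. -/
theorem norm_two_point_estimator_le {E : Type*} [NormedAddCommGroup E] [NormedSpace ℝ E]
    {a δ D L R c : ℝ} (ha : 0 ≤ a) (hδ : 0 < δ) (hD : 0 ≤ D) (hL : 0 ≤ L) {f : E → ℝ}
    (hf : ∀ x y, |f x - f y| ≤ L * ‖x - y‖) {x y e u : E} (he : ‖e‖ = 1) (hu : ‖u‖ ≤ 1)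
    (hR : ‖x - y‖ ≤ R) (hA : |f (x + δ • u) - c| ≤ D * ‖x - y + δ • (u - e)‖) :
    ‖(a / (2 * δ) * (f (x + δ • u) - 2 * c + f (x - δ • u))) • u‖ ≤
      a * L + 2 * a * D + a * D * R / δ := by
  have h₁ : ‖x - y + δ • (u - e)‖ ≤ R + δ * 2 := by
    refine (norm_add_le _ _).trans (add_le_add hR ?_)
    rw [norm_smul, Real.norm_of_nonneg hδ.le]
    gcongr
    linarith [norm_sub_le u e]
  have h₂ : |f (x - δ • u) - f (x + δ • u)| ≤ L * (2 * δ) := by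
    refine (hf _ _).trans (mul_le_mul_of_nonneg_left ?_ hL)
    have : x - δ • u - (x + δ • u) = -((2 * δ) • u) := by module
    rw [this, norm_neg, norm_smul, Real.norm_of_nonneg (by positivity)]
    exact mul_le_of_le_one_right (by positivity) hu
  have h₃ : |f (x + δ • u) - 2 * c + f (x - δ • u)| ≤ 2 * (D * (R + δ * 2)) + L * (2 * δ) := by
    have h₄ := hA.trans (mul_le_mul_of_nonneg_left h₁ hD)
    rw [abs_le] at h₂ h₄ ⊢
    constructor <;> linarith [h₂.1, h₂.2, h₄.1, h₄.2]
  calc ‖(a / (2 * δ) * (f (x + δ • u) - 2 * c + f (x - δ • u))) • u‖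
      ≤ a / (2 * δ) * |f (x + δ • u) - 2 * c + f (x - δ • u)| := by
        rw [norm_smul, norm_mul, Real.norm_of_nonneg (by positivity), Real.norm_eq_abs]
        exact mul_le_of_le_one_right (by positivity) hu
    _ ≤ a / (2 * δ) * (2 * (D * (R + δ * 2)) + L * (2 * δ)) := by gcongr
    _ = a * L + 2 * a * D + a * D * R / δ := by
        field_simp
        ring

/-- Bound on the bias of the (per-step) LAZOa gradient estimator:
if `‖x_t − x_{t−1}‖ ≤ η‖v‖` then
`E_u[‖b̃(u)‖] ≤ (dL + 2dD + (dDη/δ)‖v‖)·σ(Ã ∖ Ã^s)`. -/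
theorem stmt11 (d : ℕ) (hd : 1 ≤ d) (δ η D L : ℝ) (hδ : 0 < δ) (hη : 0 < η) (hD : 0 < D)
    (hL : 0 ≤ L)
    (ft ftm : EuclideanSpace ℝ (Fin d) → ℝ)
    (hft : ∀ x y, |ft x - ft y| ≤ L * ‖x - y‖)
    (hftm : ∀ x y, |ftm x - ftm y| ≤ L * ‖x - y‖)
    (xt xtm utm : EuclideanSpace ℝ (Fin d)) (hutm : ‖utm‖ = 1)
    (v : EuclideanSpace ℝ (Fin d)) (hv : ‖xt - xtm‖ ≤ η * ‖v‖) :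
    (∫ u, ‖(asymPart
          {w : EuclideanSpace ℝ (Fin d) |
            |ft (xt + δ • w) - ftm (xtm + δ • utm)| ≤
              D * ‖xt - xtm + δ • (w - utm)‖}).indicator
        (fun u => ((d : ℝ) / (2 * δ) *
          (ft (xt + δ • u) - 2 * ftm (xtm + δ • utm) + ft (xt - δ • u))) • u) u‖
        ∂(sphereUniform d)) ≤
      (d * L + 2 * d * D + d * D * η / δ * ‖v‖) *
        (sphereUniform d (asymPart
          {w : EuclideanSpace ℝ (Fin d) |
            |ft (xt + δ • w) - ftm (xtm + δ • utm)| ≤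
              D * ‖xt - xtm + δ • (w - utm)‖})).toReal := by
  have hcont : Continuous ft := by
    have : LipschitzWith ⟨L, hL⟩ ft :=
      LipschitzWith.of_dist_le_mul fun x y => by
        rw [Real.dist_eq, dist_eq_norm]
        exact hft x y
    exact this.continuous
  refine integral_norm_indicator_le (measurableSet_asymPart (IsClosed.measurableSet
    (isClosed_le (by fun_prop) (by fun_prop)))) ?_
  filter_upwards [ae_sphereUniform_norm_le_one d] with u hu hmem
  refine (norm_two_point_estimator_le (Nat.cast_nonneg d) hδ hD.le hL hft hutm hu hv
    hmem.1).trans_eq ?_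
  ring
end

section
/- Let d ≥ 1 and T ≥ 1 be integers, R > 0, L > 0, and set η = R/(L√(dT)) and δ = R√(d/T). Let 0 < D < L/√10. Let f_0, …, f_T : ℝ^d → ℝ each be L-Lipschitz. Let (u_t)_{t=0}^T be unit vectors in ℝ^d, (x_t)_{t=0}^{T} points in ℝ^d, and (g_t)_{t=0}^T vectors in ℝ^d, with w_t = x_t + δu_t, such that: g_0 = (d/(2δ))(f_0(w_0) − f_0(x_0 − δu_0)) u_0; for each 1 ≤ t ≤ T, ‖x_t − x_{t−1}‖ ≤ η‖g_{t−1}‖; and for each 1 ≤ t ≤ T, either (one-point branch) |f_t(w_t) − f_{t−1}(w_{t−1})| ≤ D‖w_t − w_{t−1}‖ and g_t = (d/δ)(f_t(w_t) − f_{t−1}(w_{t−1})) u_t, or (two-point branch) g_t = (d/(2δ))(f_t(w_t) − f_t(x_t − δu_t)) u_t. Then ‖g_t‖² ≤ d²L² for all 0 ≤ t ≤ T. -/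
/-- The two-point gradient estimate of an `L`-Lipschitz function has norm at most `d * L`. -/
theorem norm_two_point_estimate_le {E : Type*} [NormedAddCommGroup E] [NormedSpace ℝ E]
    {d δ L : ℝ} (hd : 0 ≤ d) (hδ : 0 < δ) {f : E → ℝ} (hf : ∀ a b, |f a - f b| ≤ L * ‖a - b‖)
    {x u : E} (hu : ‖u‖ = 1) :
    ‖(d / (2 * δ) * (f (x + δ • u) - f (x - δ • u))) • u‖ ≤ d * L := by
  have hdist : ‖(x + δ • u) - (x - δ • u)‖ = 2 * δ := by
    rw [show (x + δ • u) - (x - δ • u) = (2 * δ) • u by module, norm_smul, hu, mul_one,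
      Real.norm_of_nonneg (by positivity)]
  have h := hf (x + δ • u) (x - δ • u)
  rw [hdist] at h
  rw [norm_smul, hu, mul_one, norm_mul, Real.norm_of_nonneg (by positivity), Real.norm_eq_abs]
  calc d / (2 * δ) * |f (x + δ • u) - f (x - δ • u)| ≤ d / (2 * δ) * (L * (2 * δ)) := by gcongr
    _ = d * L := by field_simp

/-- The perturbed points move by at most the step length plus twice the perturbation radius. -/
theorem norm_perturbed_sub_le {E : Type*} [NormedAddCommGroup E] [NormedSpace ℝ E]
    {δ : ℝ} (hδ : 0 ≤ δ) (x y : E) {u v : E} (hu : ‖u‖ = 1) (hv : ‖v‖ = 1) :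
    ‖(x + δ • u) - (y + δ • v)‖ ≤ ‖x - y‖ + 2 * δ := by
  have h₁ : ‖δ • u‖ = δ := by rw [norm_smul, hu, mul_one, Real.norm_of_nonneg hδ]
  have h₂ : ‖δ • v‖ = δ := by rw [norm_smul, hv, mul_one, Real.norm_of_nonneg hδ]
  rw [add_sub_add_comm]
  linarith [norm_add_le (x - y) (δ • u - δ • v), norm_sub_le (δ • u) (δ • v)]


/-- Lemma 8 (boundedness of the LAZOa estimator along a trajectory): with
`η = R/(L√(dT))`, `δ = R√(d/T)` and `0 < D < L/√10`, every LAZOa gradient estimate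
satisfies `‖g_t‖² ≤ d²L²`. -/
theorem stmt13 (d T : ℕ) (hd : 1 ≤ d) (hT : 1 ≤ T) (R L : ℝ) (hR : 0 < R) (hL : 0 < L)
    (η δ : ℝ) (hη : η = R / (L * Real.sqrt (d * T))) (hδ : δ = R * Real.sqrt (d / T))
    (D : ℝ) (hD0 : 0 < D) (hD : D < L / Real.sqrt 10)
    (f : ℕ → EuclideanSpace ℝ (Fin d) → ℝ)
    (hf : ∀ t ≤ T, ∀ a b, |f t a - f t b| ≤ L * ‖a - b‖)
    (u x g w : ℕ → EuclideanSpace ℝ (Fin d))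
    (hu : ∀ t ≤ T, ‖u t‖ = 1)
    (hw : ∀ t ≤ T, w t = x t + δ • u t)
    (hg0 : g 0 = ((d : ℝ) / (2 * δ) * (f 0 (w 0) - f 0 (x 0 - δ • u 0))) • u 0)
    (hstep : ∀ t, 1 ≤ t → t ≤ T → ‖x t - x (t - 1)‖ ≤ η * ‖g (t - 1)‖)
    (hgt : ∀ t, 1 ≤ t → t ≤ T →
      (|f t (w t) - f (t - 1) (w (t - 1))| ≤ D * ‖w t - w (t - 1)‖ ∧
        g t = ((d : ℝ) / δ * (f t (w t) - f (t - 1) (w (t - 1)))) • u t) ∨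
      g t = ((d : ℝ) / (2 * δ) * (f t (w t) - f t (x t - δ • u t))) • u t) :
    ∀ t ≤ T, ‖g t‖ ^ 2 ≤ (d : ℝ) ^ 2 * L ^ 2 := by
  have hd' : (0 : ℝ) < d := by exact_mod_cast hd
  have hT' : (0 : ℝ) < T := by exact_mod_cast hT
  have hδ0 : 0 < δ := by rw [hδ]; positivity
  have hη0 : 0 ≤ η := by rw [hη]; positivity
  have hηδ : η * (d * L) = δ := by
    have hsq := Real.mul_self_sqrt hd'.le
    rw [hη, hδ, Real.sqrt_mul hd'.le, Real.sqrt_div hd'.le]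
    field_simp
    linarith
  have hD3 : D * 3 ≤ L := by
    have h3 : (3 : ℝ) ≤ Real.sqrt 10 := Real.le_sqrt_of_sq_le (by norm_num)
    rw [lt_div_iff₀ (by positivity)] at hD
    nlinarith
  suffices h : ∀ t ≤ T, ‖g t‖ ≤ d * L by
    intro t ht
    rw [← mul_pow]
    exact pow_le_pow_left₀ (norm_nonneg _) (h t ht) 2
  intro t
  induction t with
  | zero =>
    intro ht
    rw [hg0, hw 0 ht]
    exact norm_two_point_estimate_le hd'.le hδ0 (hf 0 ht) (hu 0 ht)
  | succ t ih =>
    intro ht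
    have ht' : t ≤ T := by omega
    rcases hgt (t + 1) (by omega) ht with ⟨hf', hg⟩ | hg
    · have hx := hstep (t + 1) (by omega) ht
      rw [Nat.add_sub_cancel] at hx hf' hg
      have hmove : ‖w (t + 1) - w t‖ ≤ 3 * δ := by
        rw [hw _ ht, hw _ ht']
        have hηg : η * ‖g t‖ ≤ η * (d * L) := by gcongr; exact ih ht'
        linarith [norm_perturbed_sub_le hδ0.le (x (t + 1)) (x t) (hu _ ht) (hu _ ht')]
      rw [hg, norm_smul, hu _ ht, mul_one, norm_mul, Real.norm_of_nonneg (by positivity),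
        Real.norm_eq_abs]
      calc (d : ℝ) / δ * |f (t + 1) (w (t + 1)) - f t (w t)|
          ≤ d / δ * (D * (3 * δ)) := by gcongr; exact hf'.trans (by gcongr)
        _ = d * (D * 3) := by field_simp
        _ ≤ d * L := by gcongr
    · rw [hg, hw _ ht]
      exact norm_two_point_estimate_le hd'.le hδ0 (hf _ ht) (hu _ ht)
end
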